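/- arXiv:1505.02439 — 10 statements merged into one kernel-verified Lean document; each statement's English description precedes it below -/
import Mathlib

section
/- Let (A,μ,α) be a Hom-associative algebra over a field K. Define the commutator bracket [x,y] := μ(x,y) − μ(y,x). Then (A,[·,·],α) is a Hom-Lie algebra: [·,·] is skew-symmetric and bilinear, α([x,y]) = [α(x),α(y)] for all x,y ∈ A, and the Hom-Jacobi identity [α(x),[y,z]] + [α(y),[z,x]] + [α(z),[x,y]] = 0 holds for all x,y,z ∈ A. -/
/-- The commutator bracket of a Hom-associative algebra. -/
def commutatorBracket {K A : Type*} [Field K] [AddCommGroup A] [Module K A]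
    (μ : A →ₗ[K] A →ₗ[K] A) (x y : A) : A :=
  μ x y - μ y x

/-- The commutator of a Hom-associative algebra `(A, μ, α)` gives a Hom-Lie
algebra `(A, [·,·], α)`: the bracket is skew-symmetric and bilinear, `α`
is multiplicative for it, and the Hom-Jacobi identity holds. -/
theorem homAssociative_commutator_homLie {K A : Type*} [Field K] [AddCommGroup A] [Module K A]
    (μ : A →ₗ[K] A →ₗ[K] A) (α : A →ₗ[K] A)
    (mult : ∀ x y : A, α (μ x y) = μ (α x) (α y))
    (hassoc : ∀ x y z : A, μ (α x) (μ y z) = μ (μ x y) (α z)) :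
    (∀ x y : A, commutatorBracket μ x y = - commutatorBracket μ y x) ∧
    (∀ x y z : A, commutatorBracket μ (x + y) z
        = commutatorBracket μ x z + commutatorBracket μ y z) ∧
    (∀ (c : K) (x y : A), commutatorBracket μ (c • x) y = c • commutatorBracket μ x y) ∧
    (∀ x y z : A, commutatorBracket μ x (y + z)
        = commutatorBracket μ x y + commutatorBracket μ x z) ∧
    (∀ (c : K) (x y : A), commutatorBracket μ x (c • y) = c • commutatorBracket μ x y) ∧
    (∀ x y : A, α (commutatorBracket μ x y) = commutatorBracket μ (α x) (α y)) ∧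
    (∀ x y z : A,
      commutatorBracket μ (α x) (commutatorBracket μ y z)
        + commutatorBracket μ (α y) (commutatorBracket μ z x)
        + commutatorBracket μ (α z) (commutatorBracket μ x y) = 0) := by
  refine ⟨fun x y => ?_, fun x y z => ?_, fun c x y => ?_, fun x y z => ?_, fun c x y => ?_,
    fun x y => ?_, fun x y z => ?_⟩
  · simp [commutatorBracket]
  · simp only [commutatorBracket, map_add, LinearMap.add_apply]
    abel
  · simp [commutatorBracket, smul_sub]
  · simp only [commutatorBracket, map_add, LinearMap.add_apply]
    abel
  · simp [commutatorBracket, smul_sub]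
  · simp [commutatorBracket, mult]
  · simp only [commutatorBracket, map_sub, LinearMap.sub_apply, hassoc]
    abel
end

section
/- Let (A,μ,α,𝟙) be a unital Hom-associative algebra over a field K. Then the unit 𝟙 is hom-invertible (with hom-inverse 𝟙 and index 0), and the product of two hom-invertible elements is hom-invertible: if x,y,x',y' ∈ A and k,k' ∈ ℕ satisfy α^k(μ(x,y)) = α^k(μ(y,x)) = 𝟙 and α^{k'}(μ(x',y')) = α^{k'}(μ(y',x')) = 𝟙, then α^{k+k'+2}(μ(μ(x,x'), μ(y',y))) = α^{k+k'+2}(μ(μ(y',y), μ(x,x'))) = 𝟙, so μ(x,x') is hom-invertible with hom-inverse μ(y',y) and invertibility index at most k+k'+2. -/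
/-- In a Hom-associative algebra, the inner factors of `(a b) (c d)` can be brought together
after one application of the twisting map. -/
theorem homAssoc_mul_mul_mul {K A : Type*} [Field K] [AddCommGroup A] [Module K A]
    (μ : A →ₗ[K] A →ₗ[K] A) (α : A →ₗ[K] A)
    (mult : ∀ x y : A, α (μ x y) = μ (α x) (α y))
    (hassoc : ∀ x y z : A, μ (α x) (μ y z) = μ (μ x y) (α z)) (a b c d : A) :
    α (μ (μ a b) (μ c d)) = μ (α (α a)) (μ (μ b c) (α d)) := by
  rw [mult, mult a b, ← hassoc, hassoc b]

theorem pow_map_mul {K A : Type*} [Field K] [AddCommGroup A] [Module K A]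
    (μ : A →ₗ[K] A →ₗ[K] A) (α : A →ₗ[K] A)
    (mult : ∀ x y : A, α (μ x y) = μ (α x) (α y)) (n : ℕ) (x y : A) :
    (α ^ n) (μ x y) = μ ((α ^ n) x) ((α ^ n) y) := by
  induction n with
  | zero => simp
  | succ n ih => rw [pow_succ', Module.End.mul_apply, ih, mult]; rfl

/-- If `b c` and `a d` become the unit after `j` and `i` applications of the twisting map, then
`(a b) (c d)` does so after `i + j + 2` applications. -/
theorem pow_map_mul_mul_mul_eq_one {K A : Type*} [Field K] [AddCommGroup A] [Module K A]
    (μ : A →ₗ[K] A →ₗ[K] A) (α : A →ₗ[K] A) (one : A)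
    (mult : ∀ x y : A, α (μ x y) = μ (α x) (α y))
    (hassoc : ∀ x y z : A, μ (α x) (μ y z) = μ (μ x y) (α z))
    (one_mul : ∀ x : A, μ one x = α x) (alpha_one : α one = one)
    {a b c d : A} {i j : ℕ} (had : (α ^ i) (μ a d) = one) (hbc : (α ^ j) (μ b c) = one) :
    (α ^ (i + j + 2)) (μ (μ a b) (μ c d)) = one := by
  have hone (n : ℕ) : (α ^ n) one = one := by
    rw [Module.End.pow_apply, Function.iterate_fixed alpha_one]
  have key : (α ^ j) (α (μ (μ a b) (μ c d))) = (α ^ (j + 2)) (μ a d) := by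
    rw [homAssoc_mul_mul_mul μ α mult hassoc, pow_map_mul μ α mult, pow_map_mul μ α mult j (μ b c),
      hbc, one_mul, pow_map_mul μ α mult]
    simp only [Module.End.pow_apply, ← Function.iterate_succ_apply, ← Function.iterate_succ_apply']
  calc (α ^ (i + j + 2)) (μ (μ a b) (μ c d))
      = (α ^ (i + 1)) ((α ^ j) (α (μ (μ a b) (μ c d)))) := by
        rw [show i + j + 2 = (i + 1) + (j + 1) by omega, pow_add α (i + 1), pow_succ α j]
        rfl
    _ = (α ^ (j + 3)) ((α ^ i) (μ a d)) := by
        rw [key, ← Module.End.mul_apply (α ^ (i + 1)), ← Module.End.mul_apply (α ^ (j + 3)),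
          ← pow_add, ← pow_add, show i + 1 + (j + 2) = j + 3 + i by omega]
    _ = one := by rw [had, hone]


/-- In a unital Hom-associative algebra, the unit is hom-invertible with
invertibility index `0`, and the product of hom-invertible elements is
hom-invertible, with an explicit bound `k + k' + 2` on the invertibility
index. -/
theorem homInvertible_unit_and_mul {K A : Type*} [Field K] [AddCommGroup A] [Module K A]
    (μ : A →ₗ[K] A →ₗ[K] A) (α : A →ₗ[K] A) (one : A)
    (mult : ∀ x y : A, α (μ x y) = μ (α x) (α y))
    (hassoc : ∀ x y z : A, μ (α x) (μ y z) = μ (μ x y) (α z))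
    (mul_one : ∀ x : A, μ x one = α x)
    (one_mul : ∀ x : A, μ one x = α x)
    (alpha_one : α one = one) :
    ((α ^ 0) (μ one one) = one) ∧
    (∀ (x y x' y' : A) (k k' : ℕ),
      (α ^ k) (μ x y) = one → (α ^ k) (μ y x) = one →
      (α ^ k') (μ x' y') = one → (α ^ k') (μ y' x') = one →
      (α ^ (k + k' + 2)) (μ (μ x x') (μ y' y)) = one ∧
      (α ^ (k + k' + 2)) (μ (μ y' y) (μ x x')) = one) := by
  refine ⟨by simp [mul_one, alpha_one], fun x y x' y' k k' hxy hyx hxy' hyx' => ⟨?_, ?_⟩⟩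
  · exact pow_map_mul_mul_mul_eq_one μ α one mult hassoc one_mul alpha_one hxy hxy'
  · rw [Nat.add_comm k k']
    exact pow_map_mul_mul_mul_eq_one μ α one mult hassoc one_mul alpha_one hyx' hyx
end

section
/- Let (A,μ,α,𝟙,Δ,β,ε) be an (α,β)-Hom-bialgebra over a field K. On the space of K-linear endomorphisms of A define the convolution product f⋆g := μ∘(f⊗g)∘Δ, the map γ(f) := α∘f∘β, and the element η∘ε, where η : K → A is η(c) = c𝟙. Then (End(A), ⋆, γ) is a unital Hom-associative algebra with unit η∘ε: γ(f⋆g) = γ(f)⋆γ(g), (f⋆g)⋆γ(h) = γ(f)⋆(g⋆h), f⋆(η∘ε) = (η∘ε)⋆f = γ(f), and γ(η∘ε) = η∘ε, for all linear endomorphisms f,g,h of A. -/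
open TensorProduct

/-- An `(α,β)`-Hom-bialgebra over a field `K`. -/
structure HomBialgebra (K A : Type*) [Field K] [AddCommGroup A] [Module K A] where
  mul : A →ₗ[K] A →ₗ[K] A
  alpha : A →ₗ[K] A
  one : A
  comul : A →ₗ[K] A ⊗[K] A
  beta : A →ₗ[K] A
  counit : A →ₗ[K] K
  alpha_mul : ∀ x y : A, alpha (mul x y) = mul (alpha x) (alpha y)
  hom_assoc : ∀ x y z : A, mul (alpha x) (mul y z) = mul (mul x y) (alpha z)
  mul_one : ∀ x : A, mul x one = alpha x
  one_mul : ∀ x : A, mul one x = alpha x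
  alpha_one : alpha one = one
  coassoc : ∀ x : A,
    TensorProduct.map beta comul (comul x)
      = TensorProduct.assoc K A A A (TensorProduct.map comul beta (comul x))
  counit_comul_left : ∀ x : A,
    TensorProduct.lid K A (TensorProduct.map counit LinearMap.id (comul x)) = beta x
  counit_comul_right : ∀ x : A,
    TensorProduct.rid K A (TensorProduct.map LinearMap.id counit (comul x)) = beta x
  counit_beta : ∀ x : A, counit (beta x) = counit x
  comul_mul : ∀ x y : A,
    comul (mul x y) = TensorProduct.map₂ mul mul (comul x) (comul y)
  comul_one : comul one = one ⊗ₜ[K] one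
  counit_one : counit one = 1
  counit_mul : ∀ x y : A, counit (mul x y) = counit x * counit y
  counit_alpha : ∀ x : A, counit (alpha x) = counit x

/-- The convolution product `f ⋆ g = μ ∘ (f ⊗ g) ∘ Δ` on endomorphisms of a
Hom-bialgebra. -/
noncomputable def HomBialgebra.conv {K A : Type*} [Field K] [AddCommGroup A] [Module K A]
    (h : HomBialgebra K A) (f g : A →ₗ[K] A) : A →ₗ[K] A :=
  TensorProduct.lift h.mul ∘ₗ TensorProduct.map f g ∘ₗ h.comul

/-- The twisting map `γ(f) = α ∘ f ∘ β` on endomorphisms. -/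
def HomBialgebra.gamma {K A : Type*} [Field K] [AddCommGroup A] [Module K A]
    (h : HomBialgebra K A) (f : A →ₗ[K] A) : A →ₗ[K] A :=
  h.alpha ∘ₗ f ∘ₗ h.beta

/-- The convolution unit `η ∘ ε : x ↦ ε(x) • 𝟙`. -/
noncomputable def HomBialgebra.convUnit {K A : Type*} [Field K] [AddCommGroup A] [Module K A]
    (h : HomBialgebra K A) : A →ₗ[K] A :=
  LinearMap.smulRight h.counit h.one

namespace HomBialgebra

variable {K A : Type*} [Field K] [AddCommGroup A] [Module K A] (h : HomBialgebra K A)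

/-- Comultiplicativity of `β` follows from Hom-coassociativity and the counit axioms. -/
theorem comul_beta (x : A) :
    h.comul (h.beta x) = TensorProduct.map h.beta h.beta (h.comul x) := by
  have hl (t : A ⊗[K] A) :
      TensorProduct.map LinearMap.id
          ((TensorProduct.rid K A).toLinearMap ∘ₗ TensorProduct.map LinearMap.id h.counit)
          (TensorProduct.map h.beta h.comul t) = TensorProduct.map h.beta h.beta t := by
    induction t with
    | zero => simp
    | tmul a b => simp [h.counit_comul_right]
    | add s t hs ht => simp only [map_add, hs, ht]
  have hassoc (s : A ⊗[K] A) (c : A) :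
      TensorProduct.map LinearMap.id
          ((TensorProduct.rid K A).toLinearMap ∘ₗ TensorProduct.map LinearMap.id h.counit)
          (TensorProduct.assoc K A A A (s ⊗ₜ[K] c)) = h.counit c • s := by
    induction s with
    | zero => simp
    | tmul a b => simp
    | add s t hs ht => simp only [TensorProduct.add_tmul, map_add, hs, ht, smul_add]
  have hr (t : A ⊗[K] A) :
      TensorProduct.map LinearMap.id
          ((TensorProduct.rid K A).toLinearMap ∘ₗ TensorProduct.map LinearMap.id h.counit)
          (TensorProduct.assoc K A A A (TensorProduct.map h.comul h.beta t)) =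
        h.comul (TensorProduct.rid K A (TensorProduct.map LinearMap.id h.counit t)) := by
    induction t with
    | zero => simp
    | tmul a b => rw [TensorProduct.map_tmul, hassoc]; simp [h.counit_beta]
    | add s t hs ht => simp only [map_add, hs, ht]
  rw [← hl, h.coassoc, hr, h.counit_comul_right]

theorem gamma_conv (f g : A →ₗ[K] A) :
    h.gamma (h.conv f g) = h.conv (h.gamma f) (h.gamma g) := by
  have key (t : A ⊗[K] A) :
      h.alpha (TensorProduct.lift h.mul
          (TensorProduct.map f g (TensorProduct.map h.beta h.beta t))) =
        TensorProduct.lift h.mul (TensorProduct.map (h.gamma f) (h.gamma g) t) := by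
    induction t with
    | zero => simp
    | tmul a b => simp [gamma, h.alpha_mul]
    | add s t hs ht => simp only [map_add, hs, ht]
  ext x
  simpa [gamma, conv, h.comul_beta] using key (h.comul x)

theorem conv_conv_gamma (f g k : A →ₗ[K] A) :
    h.conv (h.conv f g) (h.gamma k) = h.conv (h.gamma f) (h.conv g k) := by
  have hassoc :
      TensorProduct.lift h.mul ∘ₗ TensorProduct.map (TensorProduct.lift h.mul) h.alpha ∘ₗ
          TensorProduct.map (TensorProduct.map f g) k =
        TensorProduct.lift h.mul ∘ₗ TensorProduct.map h.alpha (TensorProduct.lift h.mul) ∘ₗ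
          TensorProduct.map f (TensorProduct.map g k) ∘ₗ
            (TensorProduct.assoc K A A A).toLinearMap := by
    refine TensorProduct.ext_threefold fun a b c => ?_
    simp [h.hom_assoc]
  ext x
  have hx := LinearMap.congr_fun hassoc (TensorProduct.map h.comul h.beta (h.comul x))
  simp only [LinearMap.comp_apply, LinearEquiv.coe_coe, ← h.coassoc] at hx
  simpa only [conv, gamma, TensorProduct.map_comp, LinearMap.comp_apply] using hx

theorem conv_convUnit (f : A →ₗ[K] A) : h.conv f h.convUnit = h.gamma f := by
  have key (t : A ⊗[K] A) :
      TensorProduct.lift h.mul (TensorProduct.map f h.convUnit t) =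
        h.alpha (f (TensorProduct.rid K A (TensorProduct.map LinearMap.id h.counit t))) := by
    induction t with
    | zero => simp
    | tmul a b => simp [convUnit, h.mul_one]
    | add s t hs ht => simp only [map_add, hs, ht]
  ext x
  simp [conv, gamma, key, h.counit_comul_right]

theorem convUnit_conv (f : A →ₗ[K] A) : h.conv h.convUnit f = h.gamma f := by
  have key (t : A ⊗[K] A) :
      TensorProduct.lift h.mul (TensorProduct.map h.convUnit f t) =
        h.alpha (f (TensorProduct.lid K A (TensorProduct.map h.counit LinearMap.id t))) := by
    induction t with
    | zero => simp
    | tmul a b => simp [convUnit, h.one_mul]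
    | add s t hs ht => simp only [map_add, hs, ht]
  ext x
  simp [conv, gamma, key, h.counit_comul_left]

theorem gamma_convUnit : h.gamma h.convUnit = h.convUnit := by
  ext x
  simp [gamma, convUnit, h.counit_beta, h.alpha_one]

end HomBialgebra

/-- For an `(α,β)`-Hom-bialgebra `A`, the endomorphisms of `A` with the
convolution product `⋆`, the twist `γ(f) = α∘f∘β`, and unit `η∘ε` form a
unital Hom-associative algebra. -/
theorem homBialgebra_convolution_homAssociative {K A : Type*} [Field K]
    [AddCommGroup A] [Module K A] (h : HomBialgebra K A) :
    (∀ f g : A →ₗ[K] A, h.gamma (h.conv f g) = h.conv (h.gamma f) (h.gamma g)) ∧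
    (∀ f g f' : A →ₗ[K] A,
      h.conv (h.conv f g) (h.gamma f') = h.conv (h.gamma f) (h.conv g f')) ∧
    (∀ f : A →ₗ[K] A, h.conv f h.convUnit = h.gamma f) ∧
    (∀ f : A →ₗ[K] A, h.conv h.convUnit f = h.gamma f) ∧
    h.gamma h.convUnit = h.convUnit := by
  exact ⟨h.gamma_conv, h.conv_conv_gamma, h.conv_convUnit, h.convUnit_conv, h.gamma_convUnit⟩
end

section
/- Let (A,μ,α,𝟙,Δ,β,ε) be an (α,β)-Hom-bialgebra over a field K and let S, S' : A → A be two antipodes. Suppose k, k' ∈ ℕ are such that, as linear maps on A, α^k∘μ∘(S⊗id)∘Δ = α^k∘μ∘(id⊗S)∘Δ = η∘ε and α^{k'}∘μ∘(S'⊗id)∘Δ = α^{k'}∘μ∘(id⊗S')∘Δ = η∘ε, where η(c) = c𝟙. Then, with K₀ = max(k,k'), one has α^{K₀+2}(S(β²(x))) = α^{K₀+2}(S'(β²(x))) for every x ∈ A. -/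
open TensorProduct

namespace HomBialgebra

variable {K A : Type*} [Field K] [AddCommGroup A] [Module K A] (h : HomBialgebra K A)

theorem conv_apply (f g : A →ₗ[K] A) (x : A) :
    h.conv f g x = TensorProduct.lift h.mul (TensorProduct.map f g (h.comul x)) := rfl

/-- Convolution is Hom-associative with respect to `gamma`. -/
theorem conv_gamma_conv (f g l : A →ₗ[K] A) :
    h.conv (h.gamma f) (h.conv g l) = h.conv (h.conv f g) (h.gamma l) := by
  have key : TensorProduct.lift h.mul ∘ₗ
        TensorProduct.map (h.alpha ∘ₗ f) (TensorProduct.lift h.mul ∘ₗ TensorProduct.map g l) ∘ₗ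
          (TensorProduct.assoc K A A A).toLinearMap
      = TensorProduct.lift h.mul ∘ₗ
        TensorProduct.map (TensorProduct.lift h.mul ∘ₗ TensorProduct.map f g) (h.alpha ∘ₗ l) := by
    ext a b c
    simp [h.hom_assoc]
  have left : TensorProduct.map (h.gamma f) (h.conv g l)
      = TensorProduct.map (h.alpha ∘ₗ f) (TensorProduct.lift h.mul ∘ₗ TensorProduct.map g l) ∘ₗ
        TensorProduct.map h.beta h.comul := by
    rw [← TensorProduct.map_comp]; rfl
  have right : TensorProduct.map (h.conv f g) (h.gamma l)
      = TensorProduct.map (TensorProduct.lift h.mul ∘ₗ TensorProduct.map f g) (h.alpha ∘ₗ l) ∘ₗ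
        TensorProduct.map h.comul h.beta := by
    rw [← TensorProduct.map_comp]; rfl
  ext x
  rw [conv_apply, conv_apply, left, right, LinearMap.comp_apply, LinearMap.comp_apply, h.coassoc]
  exact LinearMap.congr_fun key _

theorem alpha_pow_mul (n : ℕ) (x y : A) :
    (h.alpha ^ n) (h.mul x y) = h.mul ((h.alpha ^ n) x) ((h.alpha ^ n) y) := by
  induction n with
  | zero => simp
  | succ n ih => simp [pow_succ', ih, h.alpha_mul]

theorem alpha_pow_one (n : ℕ) : (h.alpha ^ n) h.one = h.one := by
  induction n with
  | zero => simp
  | succ n ih => simp [pow_succ', ih, h.alpha_one]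

theorem alpha_pow_comp_conv (n : ℕ) (f g : A →ₗ[K] A) :
    (h.alpha ^ n) ∘ₗ h.conv f g = h.conv ((h.alpha ^ n) ∘ₗ f) ((h.alpha ^ n) ∘ₗ g) := by
  have key : (h.alpha ^ n) ∘ₗ TensorProduct.lift h.mul ∘ₗ TensorProduct.map f g
      = TensorProduct.lift h.mul ∘ₗ
        TensorProduct.map ((h.alpha ^ n) ∘ₗ f) ((h.alpha ^ n) ∘ₗ g) := by
    ext a b
    simp [alpha_pow_mul]
  ext x
  exact LinearMap.congr_fun key _

theorem alpha_pow_comp_eq_convUnit {f : A →ₗ[K] A} {k n : ℕ} (hkn : k ≤ n)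
    (hf : ∀ x, (h.alpha ^ k) (f x) = h.counit x • h.one) :
    (h.alpha ^ n) ∘ₗ f = h.convUnit := by
  ext x
  obtain ⟨m, rfl⟩ := Nat.exists_eq_add_of_le' hkn
  simp [pow_add, hf, alpha_pow_one, convUnit]

theorem gamma_alpha_pow_comp_gamma_apply (n : ℕ) (f : A →ₗ[K] A) (x : A) :
    h.gamma ((h.alpha ^ n) ∘ₗ h.gamma f) x
      = (h.alpha ^ (n + 2)) (f (h.beta (h.beta x))) := by
  rw [pow_succ, pow_succ']
  rfl

end HomBialgebra

/-- Quasi-uniqueness of the antipode: if `S` and `S'` are two antipodes of an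
`(α,β)`-Hom-bialgebra whose antipode conditions hold uniformly with indices
`k` and `k'` respectively, then `α^{max(k,k')+2} ∘ S ∘ β² = α^{max(k,k')+2} ∘ S' ∘ β²`. -/
theorem homBialgebra_antipode_quasi_unique {K A : Type*} [Field K]
    [AddCommGroup A] [Module K A] (h : HomBialgebra K A)
    (S S' : A →ₗ[K] A) (k k' : ℕ)
    (S_antimul : ∀ x y : A, S (h.mul x y) = h.mul (S y) (S x))
    (S_alpha : ∀ x : A, S (h.alpha x) = h.alpha (S x))
    (S_one : S h.one = h.one)
    (counit_S : ∀ x : A, h.counit (S x) = h.counit x)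
    (S'_antimul : ∀ x y : A, S' (h.mul x y) = h.mul (S' y) (S' x))
    (S'_alpha : ∀ x : A, S' (h.alpha x) = h.alpha (S' x))
    (S'_one : S' h.one = h.one)
    (counit_S' : ∀ x : A, h.counit (S' x) = h.counit x)
    (hS_left : ∀ x : A, (h.alpha ^ k) (h.conv S LinearMap.id x) = h.counit x • h.one)
    (hS_right : ∀ x : A, (h.alpha ^ k) (h.conv LinearMap.id S x) = h.counit x • h.one)
    (hS'_left : ∀ x : A, (h.alpha ^ k') (h.conv S' LinearMap.id x) = h.counit x • h.one)
    (hS'_right : ∀ x : A, (h.alpha ^ k') (h.conv LinearMap.id S' x) = h.counit x • h.one) :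
    ∀ x : A,
      (h.alpha ^ (max k k' + 2)) (S (h.beta (h.beta x)))
        = (h.alpha ^ (max k k' + 2)) (S' (h.beta (h.beta x))) := by
  intro x
  have unit_left := h.alpha_pow_comp_eq_convUnit (le_max_left k k') hS_left
  have unit_right := h.alpha_pow_comp_eq_convUnit (le_max_right k k') hS'_right
  have assoc := congrArg ((h.alpha ^ max k k') ∘ₗ ·) (h.conv_gamma_conv S LinearMap.id S')
  simp only [h.alpha_pow_comp_conv _ (h.gamma S), h.alpha_pow_comp_conv _ _ (h.gamma S'),
    unit_left, unit_right, h.conv_convUnit, h.convUnit_conv] at assoc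
  simpa only [h.gamma_alpha_pow_comp_gamma_apply] using LinearMap.congr_fun assoc x
end

section
/- Let (A,μ,α,𝟙,Δ,β,ε) be an (α,β)-Hom-bialgebra over a field K and let x, y ∈ A be primitive elements, i.e. Δ(x) = x⊗𝟙 + 𝟙⊗x and Δ(y) = y⊗𝟙 + 𝟙⊗y. Then the commutator [x,y] := μ(x,y) − μ(y,x) is again a primitive element: Δ([x,y]) = [x,y]⊗𝟙 + 𝟙⊗[x,y]. -/
open TensorProduct

/-- The commutator of two primitive elements of an `(α,β)`-Hom-bialgebra is
again primitive. -/
theorem homBialgebra_commutator_primitive {K A : Type*} [Field K]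
    [AddCommGroup A] [Module K A] (h : HomBialgebra K A) (x y : A)
    (hx : h.comul x = x ⊗ₜ[K] h.one + h.one ⊗ₜ[K] x)
    (hy : h.comul y = y ⊗ₜ[K] h.one + h.one ⊗ₜ[K] y) :
    h.comul (h.mul x y - h.mul y x)
      = (h.mul x y - h.mul y x) ⊗ₜ[K] h.one + h.one ⊗ₜ[K] (h.mul x y - h.mul y x) := by
  have hone : h.mul h.one h.one = h.one := (h.mul_one _).trans h.alpha_one
  simp only [map_sub, h.comul_mul, hx, hy, map_add, LinearMap.add_apply,
    TensorProduct.map₂_apply_tmul, TensorProduct.map_tmul, hone, h.mul_one, h.one_mul,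
    TensorProduct.sub_tmul, TensorProduct.tmul_sub]
  abel
end

section
/- Let A be a Hopf algebra over a field K, with comultiplication Δ, counit ε, multiplication m, unit 1 and antipode S, and let α, β : A → A be bialgebra morphisms such that α∘β = β∘α and S∘α = α∘S. Then the (α,β)-twist of A (with twisted product μ_α = α∘m and twisted coproduct Δ_β = Δ∘β) admits S as an antipode with invertibility index 0: for every x ∈ A, α(m((S⊗id)(Δ(β(x))))) = ε(x)·1 and α(m((id⊗S)(Δ(β(x))))) = ε(x)·1. -/
open TensorProduct

/-- The `(α,β)`-twist of an ordinary Hopf algebra `A`, for commuting bialgebra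
endomorphisms `α, β` with `S ∘ α = α ∘ S`, admits the antipode `S` with
invertibility index `0`: for all `x`,
`α(m((S⊗id)(Δ(β x)))) = ε(x)·1 = α(m((id⊗S)(Δ(β x))))`. -/
theorem twisted_hopfAlgebra_antipode_index_zero {K A : Type*} [Field K] [Ring A]
    [HopfAlgebra K A] (α β : A →ₐc[K] A)
    (hcomm : ∀ x : A, α (β x) = β (α x))
    (hSα : ∀ x : A, HopfAlgebra.antipode (R := K) (α x) = α (HopfAlgebra.antipode (R := K) x)) :
    ∀ x : A,
      α (LinearMap.mul' K A
          (TensorProduct.map (HopfAlgebra.antipode (R := K)) LinearMap.id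
            (Coalgebra.comul (R := K) (β x))))
        = Coalgebra.counit (R := K) x • (1 : A) ∧
      α (LinearMap.mul' K A
          (TensorProduct.map LinearMap.id (HopfAlgebra.antipode (R := K))
            (Coalgebra.comul (R := K) (β x))))
        = Coalgebra.counit (R := K) x • (1 : A) := by
  intro x
  have hε : Coalgebra.counit (R := K) (β x) = Coalgebra.counit (R := K) x :=
    CoalgHomClass.counit_comp_apply β x
  have hα : α (algebraMap K A (Coalgebra.counit (R := K) (β x)))
      = Coalgebra.counit (R := K) x • (1 : A) := by
    rw [hε, Algebra.algebraMap_eq_smul_one, map_smul, map_one]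
  exact ⟨(congrArg α (HopfAlgebra.mul_antipode_rTensor_comul_apply (R := K) (β x))).trans hα,
    (congrArg α (HopfAlgebra.mul_antipode_lTensor_comul_apply (R := K) (β x))).trans hα⟩
end

section
/- Let K be a field and let 𝕋 be the K-vector space with basis the set of weighted planar binary trees together with an extra basis vector 𝟙, equipped with the coproduct Δ : 𝕋 → 𝕋⊗𝕋 (given on a weighted tree φ with n leaves by Δ(φ) = Σ_{I⊆{1,…,n}} φ_I ⊗ φ_{I^c}, and Δ(𝟙) = 𝟙⊗𝟙) and the counit ε : 𝕋 → K (ε(𝟙) = 1, ε(φ) = 0 for every weighted tree φ). Then (𝕋,Δ,ε) is a counital coassociative cocommutative coalgebra: (Δ⊗id)∘Δ = (id⊗Δ)∘Δ, τ∘Δ = Δ where τ is the flip of 𝕋⊗𝕋, and (ε⊗id)∘Δ = id = (id⊗ε)∘Δ (identifying K⊗𝕋 and 𝕋⊗K with 𝕋). -/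
open TensorProduct

/-- Weighted planar binary trees: a leaf carrying a weight in `ℕ`, or a
grafting of two weighted trees. -/
inductive WTree : Type
  | leaf : ℕ → WTree
  | node : WTree → WTree → WTree

/-- Add `1` to every leaf weight of a weighted tree. -/
def WTree.shift : WTree → WTree
  | .leaf a => .leaf (a + 1)
  | .node s t => .node s.shift t.shift

/-- Basis of the space `𝕋`: the weighted trees together with the extra basis
vector `𝟙` (encoded as `none`). -/
abbrev TreeBasis : Type := Option WTree

/-- The weight-shift on basis elements: `α(𝟙) = 𝟙`, and `+1` on all leaf
weights of a tree. -/
def TreeBasis.shift : TreeBasis → TreeBasis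
  | none => none
  | some t => some t.shift

/-- Grafting of basis elements: `𝟙⋆𝟙 = 𝟙`, `𝟙⋆τ = τ⋆𝟙 = α(τ)`, and grafting of
trees otherwise. -/
def TreeBasis.graft : TreeBasis → TreeBasis → TreeBasis
  | none, none => none
  | none, some t => some t.shift
  | some t, none => some t.shift
  | some s, some t => some (WTree.node s t)

variable (K : Type*) [Field K]

/-- The `K`-vector space `𝕋` with basis the weighted trees together with `𝟙`. -/
abbrev TreeSpace : Type _ := TreeBasis →₀ K

/-- Basis vectors of `𝕋`. -/
noncomputable def treeVec (s : TreeBasis) : TreeSpace K := Finsupp.single s 1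

/-- The weight-shift map `α : 𝕋 → 𝕋`. -/
noncomputable def treeAlpha : TreeSpace K →ₗ[K] TreeSpace K :=
  Finsupp.lmapDomain K K TreeBasis.shift

/-- The bilinear grafting product `∨ : 𝕋 → 𝕋 → 𝕋`. -/
noncomputable def treeVee : TreeSpace K →ₗ[K] TreeSpace K →ₗ[K] TreeSpace K :=
  Finsupp.lift (TreeSpace K →ₗ[K] TreeSpace K) K TreeBasis fun s =>
    Finsupp.lift (TreeSpace K) K TreeBasis fun t => Finsupp.single (s.graft t) 1

/-- The componentwise product on `𝕋 ⊗ 𝕋`: `(a⊗b) ∨ (c⊗d) = (a∨c)⊗(b∨d)`. -/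
noncomputable def treeVee2 :
    (TreeSpace K ⊗[K] TreeSpace K) →ₗ[K] (TreeSpace K ⊗[K] TreeSpace K) →ₗ[K]
      (TreeSpace K ⊗[K] TreeSpace K) :=
  TensorProduct.map₂ (treeVee K) (treeVee K)

/-- The coproduct on weighted trees, `Δ(φ) = Σ_I φ_I ⊗ φ_{I^c}`: on a leaf it
is `leaf ⊗ 𝟙 + 𝟙 ⊗ leaf`, and on a grafting it is given componentwise, in
accordance with `(φ∨ψ)_I = φ_{I₁} ⋆ ψ_{I₂}`. -/
noncomputable def deltaTree : WTree → TreeSpace K ⊗[K] TreeSpace K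
  | .leaf a =>
      treeVec K (some (.leaf a)) ⊗ₜ[K] treeVec K none
        + treeVec K none ⊗ₜ[K] treeVec K (some (.leaf a))
  | .node s t => treeVee2 K (deltaTree s) (deltaTree t)

/-- The coproduct on basis elements, with `Δ(𝟙) = 𝟙 ⊗ 𝟙`. -/
noncomputable def deltaBasis : TreeBasis → TreeSpace K ⊗[K] TreeSpace K
  | none => treeVec K none ⊗ₜ[K] treeVec K none
  | some t => deltaTree K t

/-- The coproduct `Δ : 𝕋 → 𝕋 ⊗ 𝕋`. -/
noncomputable def treeDelta : TreeSpace K →ₗ[K] TreeSpace K ⊗[K] TreeSpace K :=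
  Finsupp.lift (TreeSpace K ⊗[K] TreeSpace K) K TreeBasis (deltaBasis K)

/-- The counit `ε : 𝕋 → K`, `ε(𝟙) = 1` and `ε(φ) = 0` on weighted trees (the
coefficient of `𝟙`). -/
noncomputable def treeEps : TreeSpace K →ₗ[K] K := Finsupp.lapply none

theorem TensorProduct.map_map₂_of_hom {R : Type*} [CommSemiring R] {M N M' N' : Type*}
    [AddCommMonoid M] [Module R M] [AddCommMonoid N] [Module R N]
    [AddCommMonoid M'] [Module R M'] [AddCommMonoid N'] [Module R N']
    {m : M →ₗ[R] M →ₗ[R] M} {n : N →ₗ[R] N →ₗ[R] N}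
    {m' : M' →ₗ[R] M' →ₗ[R] M'} {n' : N' →ₗ[R] N' →ₗ[R] N'}
    {f : M →ₗ[R] M'} {g : N →ₗ[R] N'}
    (hf : ∀ x y, f (m x y) = m' (f x) (f y)) (hg : ∀ x y, g (n x y) = n' (g x) (g y))
    (u v : M ⊗[R] N) :
    TensorProduct.map f g (TensorProduct.map₂ m n u v)
      = TensorProduct.map₂ m' n' (TensorProduct.map f g u) (TensorProduct.map f g v) := by
  induction u with
  | zero => simp
  | add a b ha hb => simp only [map_add, LinearMap.add_apply, ha, hb]
  | tmul a b =>
    induction v with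
    | zero => simp
    | add c d hc hd => simp only [map_add, hc, hd]
    | tmul c d => simp [TensorProduct.map₂_apply_tmul, hf, hg]

theorem TensorProduct.assoc_map₂ {R : Type*} [CommSemiring R] {M : Type*}
    [AddCommMonoid M] [Module R M] (m : M →ₗ[R] M →ₗ[R] M) (u v : (M ⊗[R] M) ⊗[R] M) :
    TensorProduct.assoc R M M M
        (TensorProduct.map₂ (TensorProduct.map₂ m m) m u v)
      = TensorProduct.map₂ m (TensorProduct.map₂ m m)
          (TensorProduct.assoc R M M M u) (TensorProduct.assoc R M M M v) := by
  induction u with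
  | zero => simp
  | add a b ha hb => simp only [map_add, LinearMap.add_apply, ha, hb]
  | tmul a c =>
    induction a with
    | zero => simp
    | add a b ha hb => simp only [map_add, add_tmul, LinearMap.add_apply, ha, hb]
    | tmul a b =>
      induction v with
      | zero => simp
      | add c d hc hd => simp only [map_add, hc, hd]
      | tmul d e =>
        induction d with
        | zero => simp
        | add a b ha hb => simp only [map_add, add_tmul, ha, hb]
        | tmul d f => simp [TensorProduct.map₂_apply_tmul]

theorem TensorProduct.comm_map₂ {R : Type*} [CommSemiring R] {M : Type*}
    [AddCommMonoid M] [Module R M] (m : M →ₗ[R] M →ₗ[R] M) (u v : M ⊗[R] M) :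
    TensorProduct.comm R M M (TensorProduct.map₂ m m u v)
      = TensorProduct.map₂ m m (TensorProduct.comm R M M u) (TensorProduct.comm R M M v) := by
  induction u with
  | zero => simp
  | add a b ha hb => simp only [map_add, LinearMap.add_apply, ha, hb]
  | tmul a b =>
    induction v with
    | zero => simp
    | add c d hc hd => simp only [map_add, hc, hd]
    | tmul c d => simp [TensorProduct.map₂_apply_tmul]

theorem TensorProduct.lid_map₂_mul {R : Type*} [CommSemiring R] {M : Type*}
    [AddCommMonoid M] [Module R M] (m : M →ₗ[R] M →ₗ[R] M) (u v : R ⊗[R] M) :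
    TensorProduct.lid R M (TensorProduct.map₂ (LinearMap.mul R R) m u v)
      = m (TensorProduct.lid R M u) (TensorProduct.lid R M v) := by
  induction u with
  | zero => simp
  | add a b ha hb => simp only [map_add, LinearMap.add_apply, ha, hb]
  | tmul a b =>
    induction v with
    | zero => simp
    | add c d hc hd => simp only [map_add, hc, hd]
    | tmul c d => simp [TensorProduct.map₂_apply_tmul, smul_smul, mul_comm]

section TreeSpace

variable {K}

theorem TreeBasis.shift_graft (s t : TreeBasis) :
    (s.graft t).shift = s.shift.graft t.shift := by
  cases s <;> cases t <;> rfl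

theorem TreeBasis.graft_eq_none {s t : TreeBasis} :
    s.graft t = none ↔ s = none ∧ t = none := by
  cases s <;> cases t <;> simp [TreeBasis.graft]

theorem treeVee_treeVec (s t : TreeBasis) :
    treeVee K (treeVec K s) (treeVec K t) = treeVec K (s.graft t) := by
  simp [treeVee, treeVec]

theorem treeAlpha_treeVec (s : TreeBasis) :
    treeAlpha K (treeVec K s) = treeVec K s.shift := by
  simp [treeAlpha, treeVec]

theorem treeDelta_treeVec (s : TreeBasis) :
    treeDelta K (treeVec K s) = deltaBasis K s := by
  simp [treeDelta, treeVec]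

theorem treeEps_treeVec (s : TreeBasis) :
    treeEps K (treeVec K s) = if s = none then 1 else 0 := by
  simp [treeEps, treeVec, Finsupp.single_apply]

theorem treeSpace_hom_ext {M : Type*} [AddCommMonoid M] [Module K M]
    {F G : TreeSpace K →ₗ[K] M} (h : ∀ s, F (treeVec K s) = G (treeVec K s)) : F = G :=
  Finsupp.lhom_ext' fun s => LinearMap.ext_ring (h s)

theorem treeSpace_bilin_ext {M : Type*} [AddCommMonoid M] [Module K M]
    {F G : TreeSpace K →ₗ[K] TreeSpace K →ₗ[K] M}
    (h : ∀ s t, F (treeVec K s) (treeVec K t) = G (treeVec K s) (treeVec K t)) : F = G :=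
  treeSpace_hom_ext fun s => treeSpace_hom_ext (h s)

/-- `𝕋` is generated under grafting by `𝟙` and the leaves. -/
theorem treeSpace_hom_ext_of_vee {M : Type*} [AddCommMonoid M] [Module K M]
    {F G : TreeSpace K →ₗ[K] M} (h_one : F (treeVec K none) = G (treeVec K none))
    (h_leaf : ∀ a, F (treeVec K (some (.leaf a))) = G (treeVec K (some (.leaf a))))
    (h_vee : ∀ x y, F x = G x → F y = G y → F (treeVee K x y) = G (treeVee K x y)) :
    F = G := by
  refine treeSpace_hom_ext fun s => ?_
  cases s with
  | none => exact h_one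
  | some t =>
    induction t with
    | leaf a => exact h_leaf a
    | node s t hs ht => simpa [treeVee_treeVec, TreeBasis.graft] using h_vee _ _ hs ht

theorem treeAlpha_treeVee (x y : TreeSpace K) :
    treeAlpha K (treeVee K x y) = treeVee K (treeAlpha K x) (treeAlpha K y) := by
  suffices h : (treeVee K).compr₂ (treeAlpha K) =
      (treeVee K).compl₁₂ (treeAlpha K) (treeAlpha K) from
    LinearMap.congr_fun₂ h x y
  refine treeSpace_bilin_ext fun s t => ?_
  simp [treeVee_treeVec, treeAlpha_treeVec, TreeBasis.shift_graft]

theorem treeVee_one_left (x : TreeSpace K) :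
    treeVee K (treeVec K none) x = treeAlpha K x := by
  refine LinearMap.congr_fun (treeSpace_hom_ext fun s => ?_) x
  rw [treeVee_treeVec, treeAlpha_treeVec]
  cases s <;> rfl

theorem treeVee_one_right (x : TreeSpace K) :
    treeVee K x (treeVec K none) = treeAlpha K x := by
  refine LinearMap.congr_fun (f := (treeVee K).flip (treeVec K none))
    (treeSpace_hom_ext fun s => ?_) x
  rw [LinearMap.flip_apply, treeVee_treeVec, treeAlpha_treeVec]
  cases s <;> rfl

theorem treeVee2_one_left (u : TreeSpace K ⊗[K] TreeSpace K) :
    treeVee2 K (treeVec K none ⊗ₜ treeVec K none) u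
      = TensorProduct.map (treeAlpha K) (treeAlpha K) u := by
  induction u with
  | zero => simp
  | add a b ha hb => simp only [map_add, ha, hb]
  | tmul a b => simp [treeVee2, TensorProduct.map₂_apply_tmul, treeVee_one_left]

theorem treeVee2_one_right (u : TreeSpace K ⊗[K] TreeSpace K) :
    treeVee2 K u (treeVec K none ⊗ₜ treeVec K none)
      = TensorProduct.map (treeAlpha K) (treeAlpha K) u := by
  induction u with
  | zero => simp
  | add a b ha hb => simp only [map_add, LinearMap.add_apply, ha, hb]
  | tmul a b => simp [treeVee2, TensorProduct.map₂_apply_tmul, treeVee_one_right]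

theorem deltaTree_shift (t : WTree) :
    deltaTree K t.shift = TensorProduct.map (treeAlpha K) (treeAlpha K) (deltaTree K t) := by
  induction t with
  | leaf a => simp [WTree.shift, deltaTree, treeAlpha_treeVec, TreeBasis.shift]
  | node s t hs ht =>
    simp only [WTree.shift, deltaTree, hs, ht, treeVee2]
    exact (TensorProduct.map_map₂_of_hom treeAlpha_treeVee treeAlpha_treeVee _ _).symm

theorem deltaBasis_graft (s t : TreeBasis) :
    deltaBasis K (s.graft t) = treeVee2 K (deltaBasis K s) (deltaBasis K t) := by
  cases s <;> cases t <;>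
    simp [TreeBasis.graft, deltaBasis, deltaTree, deltaTree_shift, treeVee2_one_left,
      treeVee2_one_right, treeAlpha_treeVec, TreeBasis.shift]

theorem treeDelta_treeVee (x y : TreeSpace K) :
    treeDelta K (treeVee K x y) = treeVee2 K (treeDelta K x) (treeDelta K y) := by
  suffices h : (treeVee K).compr₂ (treeDelta K) =
      (treeVee2 K).compl₁₂ (treeDelta K) (treeDelta K) from
    LinearMap.congr_fun₂ h x y
  refine treeSpace_bilin_ext fun s t => ?_
  simp [treeVee_treeVec, treeDelta_treeVec, deltaBasis_graft]

theorem treeEps_treeVee (x y : TreeSpace K) :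
    treeEps K (treeVee K x y) = LinearMap.mul K K (treeEps K x) (treeEps K y) := by
  suffices h : (treeVee K).compr₂ (treeEps K) =
      (LinearMap.mul K K).compl₁₂ (treeEps K) (treeEps K) from
    LinearMap.congr_fun₂ h x y
  refine treeSpace_bilin_ext fun s t => ?_
  simp [treeVee_treeVec, treeEps_treeVec, TreeBasis.graft_eq_none, ← ite_and, and_comm]

theorem treeDelta_coassoc (x : TreeSpace K) :
    TensorProduct.assoc K (TreeSpace K) (TreeSpace K) (TreeSpace K)
        (TensorProduct.map (treeDelta K) LinearMap.id (treeDelta K x))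
      = TensorProduct.map LinearMap.id (treeDelta K) (treeDelta K x) := by
  refine LinearMap.congr_fun
    (f := (TensorProduct.assoc K (TreeSpace K) (TreeSpace K) (TreeSpace K)).toLinearMap ∘ₗ
      TensorProduct.map (treeDelta K) LinearMap.id ∘ₗ treeDelta K)
    (g := TensorProduct.map LinearMap.id (treeDelta K) ∘ₗ treeDelta K)
    (treeSpace_hom_ext_of_vee ?_ (fun a => ?_) fun x y hx hy => ?_) x
  · simp [treeDelta_treeVec, deltaBasis]
  · simp [treeDelta_treeVec, deltaBasis, deltaTree, add_tmul, tmul_add, add_assoc]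
  · simp only [LinearMap.comp_apply, LinearEquiv.coe_coe] at hx hy ⊢
    rw [treeDelta_treeVee, treeVee2,
      TensorProduct.map_map₂_of_hom (m' := treeVee2 K) (n' := treeVee K)
        treeDelta_treeVee fun _ _ => rfl,
      TensorProduct.map_map₂_of_hom (m' := treeVee K) (n' := treeVee2 K)
        (fun _ _ => rfl) treeDelta_treeVee,
      treeVee2, TensorProduct.assoc_map₂, hx, hy]

theorem treeDelta_cocomm (x : TreeSpace K) :
    TensorProduct.comm K (TreeSpace K) (TreeSpace K) (treeDelta K x) = treeDelta K x := by
  refine LinearMap.congr_fun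
    (f := (TensorProduct.comm K (TreeSpace K) (TreeSpace K)).toLinearMap ∘ₗ treeDelta K)
    (g := treeDelta K)
    (treeSpace_hom_ext_of_vee ?_ (fun a => ?_) fun x y hx hy => ?_) x
  · simp [treeDelta_treeVec, deltaBasis]
  · simp [treeDelta_treeVec, deltaBasis, deltaTree, add_comm]
  · simp only [LinearMap.comp_apply, LinearEquiv.coe_coe] at hx hy ⊢
    rw [treeDelta_treeVee, treeVee2, TensorProduct.comm_map₂, hx, hy]

theorem treeDelta_counit_left (x : TreeSpace K) :
    TensorProduct.lid K (TreeSpace K)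
        (TensorProduct.map (treeEps K) LinearMap.id (treeDelta K x)) = x := by
  refine LinearMap.congr_fun
    (f := (TensorProduct.lid K (TreeSpace K)).toLinearMap ∘ₗ
      TensorProduct.map (treeEps K) LinearMap.id ∘ₗ treeDelta K)
    (g := LinearMap.id)
    (treeSpace_hom_ext_of_vee ?_ (fun a => ?_) fun x y hx hy => ?_) x
  · simp [treeDelta_treeVec, deltaBasis, treeEps_treeVec]
  · simp [treeDelta_treeVec, deltaBasis, deltaTree, treeEps_treeVec]
  · simp only [LinearMap.comp_apply, LinearEquiv.coe_coe, LinearMap.id_apply] at hx hy ⊢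
    rw [treeDelta_treeVee, treeVee2,
      TensorProduct.map_map₂_of_hom (n' := treeVee K) treeEps_treeVee fun _ _ => rfl,
      TensorProduct.lid_map₂_mul, hx, hy]

theorem treeDelta_counit_right (x : TreeSpace K) :
    TensorProduct.rid K (TreeSpace K)
        (TensorProduct.map LinearMap.id (treeEps K) (treeDelta K x)) = x := by
  rw [← TensorProduct.lid_comm, ← TensorProduct.map_comm, treeDelta_cocomm,
    treeDelta_counit_left]

end TreeSpace

/-- `(𝕋, Δ, ε)` is a counital coassociative cocommutative coalgebra. -/
theorem treeSpace_coalgebra (K : Type*) [Field K] :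
    (∀ x : TreeSpace K,
      TensorProduct.assoc K (TreeSpace K) (TreeSpace K) (TreeSpace K)
          (TensorProduct.map (treeDelta K) LinearMap.id (treeDelta K x))
        = TensorProduct.map LinearMap.id (treeDelta K) (treeDelta K x)) ∧
    (∀ x : TreeSpace K,
      TensorProduct.comm K (TreeSpace K) (TreeSpace K) (treeDelta K x) = treeDelta K x) ∧
    (∀ x : TreeSpace K,
      TensorProduct.lid K (TreeSpace K)
          (TensorProduct.map (treeEps K) LinearMap.id (treeDelta K x)) = x) ∧
    (∀ x : TreeSpace K,
      TensorProduct.rid K (TreeSpace K)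
          (TensorProduct.map LinearMap.id (treeEps K) (treeDelta K x)) = x) := by
  exact ⟨treeDelta_coassoc, treeDelta_cocomm, treeDelta_counit_left,
    treeDelta_counit_right⟩
end

section
/- Let (A,μ,α) be a Hom-associative algebra over a field K and x ∈ A. For a binary tree φ with |φ| leaves and an integer k ≥ |φ|, let E_x(φ,k) ∈ A denote the canonical evaluation, defined by E_x(leaf,k) = α^{k−1}(x) and E_x(φ∨ψ,k) = μ(E_x(φ,k−1), E_x(ψ,k−1)). Then the result depends only on the number of leaves: for any two binary trees φ, ψ with the same number of leaves n and any k ≥ n, E_x(φ,k) = E_x(ψ,k). -/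
/-- Planar binary trees: a single leaf or the grafting of two binary trees. -/
inductive BTree : Type
  | leaf : BTree
  | node : BTree → BTree → BTree

/-- The number of leaves of a binary tree. -/
def BTree.leaves : BTree → ℕ
  | .leaf => 1
  | .node l r => l.leaves + r.leaves

/-- The canonical evaluation `E_x(φ,k)` of the `k`-weighted tree `φ[k]` in a
Hom-associative algebra: `E_x(leaf,k) = α^{k−1}(x)` and
`E_x(φ∨ψ,k) = μ(E_x(φ,k−1), E_x(ψ,k−1))`. -/
noncomputable def evalTree {K A : Type*} [Field K] [AddCommGroup A] [Module K A]
    (μ : A →ₗ[K] A →ₗ[K] A) (α : A →ₗ[K] A) (x : A) : BTree → ℕ → A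
  | .leaf, k => (α ^ (k - 1)) x
  | .node l r, k => μ (evalTree μ α x l (k - 1)) (evalTree μ α x r (k - 1))

theorem BTree.leaves_pos (φ : BTree) : 0 < φ.leaves := by
  induction φ with
  | leaf => exact Nat.one_pos
  | node l r ihl ihr => exact Nat.add_pos_left ihl _

/-- The right comb with `n + 1` leaves. -/
def BTree.rightComb : ℕ → BTree
  | 0 => .leaf
  | n + 1 => .node .leaf (rightComb n)

section Evaluation

variable {K A : Type*} [Field K] [AddCommGroup A] [Module K A]
  {μ : A →ₗ[K] A →ₗ[K] A} {α : A →ₗ[K] A}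

/-- Raising the weight by one applies the twisting map. -/
theorem evalTree_succ (mult : ∀ x y : A, α (μ x y) = μ (α x) (α y)) (x : A) (φ : BTree) :
    ∀ k : ℕ, φ.leaves ≤ k → evalTree μ α x φ (k + 1) = α (evalTree μ α x φ k) := by
  induction φ with
  | leaf =>
    intro k hk
    obtain ⟨m, rfl⟩ := Nat.exists_eq_add_of_le' (show 1 ≤ k from hk)
    simp [evalTree, pow_succ']
  | node l r ihl ihr =>
    intro k hk
    have hl := l.leaves_pos
    have hr := r.leaves_pos
    simp only [BTree.leaves] at hk
    obtain ⟨m, rfl⟩ := Nat.exists_eq_add_of_le' (show 1 ≤ k by omega)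
    simp only [evalTree, Nat.add_sub_cancel, mult]
    rw [ihl m (by omega), ihr m (by omega)]

/-- Evaluation is invariant under rotation at the root. -/
theorem evalTree_rotate (mult : ∀ x y : A, α (μ x y) = μ (α x) (α y))
    (hassoc : ∀ x y z : A, μ (α x) (μ y z) = μ (μ x y) (α z)) (x : A) (a b c : BTree) (k : ℕ)
    (hk : a.leaves + b.leaves + c.leaves ≤ k) :
    evalTree μ α x (.node (.node a b) c) k = evalTree μ α x (.node a (.node b c)) k := by
  have ha := a.leaves_pos
  have hb := b.leaves_pos
  have hc := c.leaves_pos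
  obtain ⟨m, rfl⟩ := Nat.exists_eq_add_of_le' (show 2 ≤ k by omega)
  simp only [evalTree, Nat.add_succ_sub_one, Nat.add_sub_cancel]
  rw [evalTree_succ mult x c m (by omega), evalTree_succ mult x a m (by omega), hassoc]

theorem evalTree_eq_rightComb (mult : ∀ x y : A, α (μ x y) = μ (α x) (α y))
    (hassoc : ∀ x y z : A, μ (α x) (μ y z) = μ (μ x y) (α z)) (x : A) (n : ℕ) :
    ∀ φ : BTree, φ.leaves = n + 1 → ∀ k : ℕ, n + 1 ≤ k →
      evalTree μ α x φ k = evalTree μ α x (.rightComb n) k := by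
  induction n with
  | zero =>
    intro φ hφ k _
    cases φ with
    | leaf => rfl
    | node l r =>
      have hl := l.leaves_pos
      have hr := r.leaves_pos
      simp only [BTree.leaves] at hφ
      omega
  | succ n ih =>
    intro φ hφ k hk
    cases φ with
    | leaf => simp [BTree.leaves] at hφ
    | node l r =>
      simp only [BTree.leaves] at hφ
      induction l generalizing r with
      | leaf =>
        simp only [BTree.leaves] at hφ
        simp only [BTree.rightComb, evalTree]
        rw [ih r (by omega) (k - 1) (by omega)]
      | node a b iha _ =>
        simp only [BTree.leaves] at hφ
        rw [evalTree_rotate mult hassoc x a b r k (by omega)]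
        exact iha (.node b r) (by simp only [BTree.leaves]; omega)

end Evaluation

/-- The canonical evaluation of a `k`-weighted `n`-tree in a Hom-associative
algebra only depends on the number `n` of leaves, provided `k ≥ n`. -/
theorem evalTree_depends_only_on_leaves {K A : Type*} [Field K] [AddCommGroup A] [Module K A]
    (μ : A →ₗ[K] A →ₗ[K] A) (α : A →ₗ[K] A)
    (mult : ∀ x y : A, α (μ x y) = μ (α x) (α y))
    (hassoc : ∀ x y z : A, μ (α x) (μ y z) = μ (μ x y) (α z))
    (x : A) :
    ∀ φ ψ : BTree, φ.leaves = ψ.leaves →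
      ∀ k : ℕ, φ.leaves ≤ k → evalTree μ α x φ k = evalTree μ α x ψ k := by
  intro φ ψ h k hk
  obtain ⟨n, hn⟩ := Nat.exists_eq_add_of_le' φ.leaves_pos
  rw [evalTree_eq_rightComb mult hassoc x n φ hn k (hn ▸ hk),
    evalTree_eq_rightComb mult hassoc x n ψ (h ▸ hn) k (hn ▸ hk)]
end

section
/- Let (A,μ,α) be a Hom-associative algebra over a field K and x ∈ A. Define R_x(n,k) ∈ A for 1 ≤ n ≤ k by R_x(1,k) = α^{k−1}(x) and R_x(n+1,k) = μ(R_x(n,k−1), α^{k−2}(x)) (the evaluation of the comb tree with n leaves and canonical k-weights). Then for all n, m ≥ 1 with n + m ≤ k + 1, μ(R_x(n,k), R_x(m,k)) = R_x(n+m, k+1); in particular, if moreover n + m ≤ k, then μ(R_x(n,k), R_x(m,k)) = α(R_x(n+m, k)). -/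
/-- The evaluation at `x` of the `k`-weighted `n`-ary product `⌊eⁿ⌋_k` (the
comb tree with `n` leaves and canonical `k`-weights):
`R_x(1,k) = α^{k−1}(x)` and `R_x(n+1,k) = μ(R_x(n,k−1), α^{k−2}(x))`.
(The value at `n = 0` is a junk value.) -/
noncomputable def combEval {K A : Type*} [Field K] [AddCommGroup A] [Module K A]
    (μ : A →ₗ[K] A →ₗ[K] A) (α : A →ₗ[K] A) (x : A) : ℕ → ℕ → A
  | 0, _ => x
  | 1, k => (α ^ (k - 1)) x
  | n + 2, k => μ (combEval μ α x (n + 1) (k - 1)) ((α ^ (k - 2)) x)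

/-- Within the admissible range of weights, `α` raises the weight of a comb product by one. -/
theorem map_combEval {K A : Type*} [Field K] [AddCommGroup A] [Module K A]
    (μ : A →ₗ[K] A →ₗ[K] A) (α : A →ₗ[K] A)
    (mult : ∀ x y : A, α (μ x y) = μ (α x) (α y)) (x : A) (n k : ℕ) (h : n + 1 ≤ k) :
    α (combEval μ α x (n + 1) k) = combEval μ α x (n + 1) (k + 1) := by
  induction n generalizing k with
  | zero =>
    obtain ⟨k, rfl⟩ := Nat.exists_eq_add_of_le' h
    simp [combEval, pow_succ']
  | succ n ih =>
    obtain ⟨k, rfl⟩ := Nat.exists_eq_add_of_le' (show 2 ≤ k by omega)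
    have hα : α ((α ^ k) x) = (α ^ (k + 1)) x := by simp [pow_succ']
    change α (μ (combEval μ α x (n + 1) (k + 1)) ((α ^ k) x)) =
      μ (combEval μ α x (n + 1) (k + 2)) ((α ^ (k + 1)) x)
    rw [mult, ih (k + 1) (by omega), hα]

/-- The product of two comb products of the same weight is a comb product. -/
theorem combEval_mul_eq_combEval_add {K A : Type*} [Field K] [AddCommGroup A] [Module K A]
    (μ : A →ₗ[K] A →ₗ[K] A) (α : A →ₗ[K] A)
    (mult : ∀ x y : A, α (μ x y) = μ (α x) (α y))
    (hassoc : ∀ x y z : A, μ (α x) (μ y z) = μ (μ x y) (α z))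
    (x : A) (n m k : ℕ) (h : n + m + 1 ≤ k) :
    μ (combEval μ α x (n + 1) k) (combEval μ α x (m + 1) k) =
      combEval μ α x (n + m + 2) (k + 1) := by
  induction m generalizing k with
  | zero => simp [combEval]
  | succ m ih =>
    obtain ⟨k, rfl⟩ := Nat.exists_eq_add_of_le' (show 2 ≤ k by omega)
    have hα : α ((α ^ k) x) = (α ^ (k + 1)) x := by simp [pow_succ']
    change μ (combEval μ α x (n + 1) (k + 2))
        (μ (combEval μ α x (m + 1) (k + 1)) ((α ^ k) x)) =
      μ (combEval μ α x (n + m + 2) (k + 2)) ((α ^ (k + 1)) x)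
    rw [← map_combEval μ α mult x n (k + 1) (by omega), hassoc, ih (k + 1) (by omega), hα]

/-- The `k`-weighted `n`-ary products multiply as
`⌊eⁿ⌋_k ∨ ⌊eᵐ⌋_k = ⌊e^{n+m}⌋_{k+1}`, and `= α(⌊e^{n+m}⌋_k)` when `n+m ≤ k`. -/
theorem combEval_mul {K A : Type*} [Field K] [AddCommGroup A] [Module K A]
    (μ : A →ₗ[K] A →ₗ[K] A) (α : A →ₗ[K] A)
    (mult : ∀ x y : A, α (μ x y) = μ (α x) (α y))
    (hassoc : ∀ x y z : A, μ (α x) (μ y z) = μ (μ x y) (α z))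
    (x : A) :
    ∀ n m k : ℕ, 1 ≤ n → 1 ≤ m →
      (n + m ≤ k + 1 →
        μ (combEval μ α x n k) (combEval μ α x m k) = combEval μ α x (n + m) (k + 1)) ∧
      (n + m ≤ k →
        μ (combEval μ α x n k) (combEval μ α x m k) = α (combEval μ α x (n + m) k)) := by
  intro n m k hn hm
  obtain ⟨n, rfl⟩ := Nat.exists_eq_add_of_le' hn
  obtain ⟨m, rfl⟩ := Nat.exists_eq_add_of_le' hm
  have hnm : n + 1 + (m + 1) = n + m + 2 := by omega
  rw [hnm]
  refine ⟨fun h => ?_, fun h => ?_⟩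
  · exact combEval_mul_eq_combEval_add μ α mult hassoc x n m k (by omega)
  · rw [combEval_mul_eq_combEval_add μ α mult hassoc x n m k (by omega),
      map_combEval μ α mult x (n + m + 1) k h]
end

section
/- Let (A,μ,α,𝟙) be a unital Hom-associative algebra over a field K and x ∈ A. Define R_x(0,k) := 𝟙 and, for 1 ≤ n ≤ k, R_x(1,k) = α^{k−1}(x), R_x(n+1,k) = μ(R_x(n,k−1), α^{k−2}(x)). Fix p ≥ 1. Then the truncated exponential exp_p(s x) := Σ_{i=0}^p (s^i/i!)·R_x(i,p)·ν^i satisfies, coefficientwise: (a) for all s, t ∈ K and all 0 ≤ m ≤ p, Σ_{i=0}^m binom(m,i)·s^i·t^{m−i}·μ(R_x(i,p), R_x(m−i,p)) = (s+t)^m·α(R_x(m,p)) (i.e. exp_p(sx) ∨ exp_p(tx) = α(exp_p((s+t)x)) modulo ν^{p+1}); and (b) for all s ∈ K and all 1 ≤ m ≤ p, Σ_{i=0}^m binom(m,i)·(−1)^{m−i}·s^m·μ(R_x(i,p), R_x(m−i,p)) = 0 (i.e. exp_p(sx) ∨ exp_p(−sx) = 𝟙 modulo ν^{p+1}). -/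
/-- The evaluation at `x` of the `k`-weighted `n`-ary product `⌊eⁿ⌋_k` in a
unital Hom-associative algebra, with `R_x(0,k) = 𝟙`, `R_x(1,k) = α^{k−1}(x)`
and `R_x(n+1,k) = μ(R_x(n,k−1), α^{k−2}(x))`. -/
noncomputable def combEvalU {K A : Type*} [Field K] [AddCommGroup A] [Module K A]
    (μ : A →ₗ[K] A →ₗ[K] A) (α : A →ₗ[K] A) (one x : A) : ℕ → ℕ → A
  | 0, _ => one
  | 1, k => (α ^ (k - 1)) x
  | n + 2, k => μ (combEvalU μ α one x (n + 1) (k - 1)) ((α ^ (k - 2)) x)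

section HomAssociative

variable {K A : Type*} [Field K] [AddCommGroup A] [Module K A]
  (μ : A →ₗ[K] A →ₗ[K] A) (α : A →ₗ[K] A) (one x : A)

/-- Applying the twisting map raises the weight by one. -/
theorem alpha_combEvalU (mult : ∀ x y : A, α (μ x y) = μ (α x) (α y)) (alpha_one : α one = one) :
    ∀ n k : ℕ, n ≤ k → α (combEvalU μ α one x n k) = combEvalU μ α one x n (k + 1)
  | 0, _, _ => alpha_one
  | 1, k + 1, _ => by simp [combEvalU, pow_succ']
  | n + 2, k + 2, h => by
    have ih := alpha_combEvalU mult alpha_one (n + 1) (k + 1) (by omega)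
    simp only [combEvalU, mult, Nat.add_sub_cancel] at ih ⊢
    rw [show k + 2 - 1 = k + 1 by omega, show k + 2 + 1 - 2 = k + 1 by omega, ih, pow_succ',
      Module.End.mul_apply]

/-- The product of two evaluations of equal weight is the twist of the evaluation of the
combined arity. -/
theorem mul_combEvalU (mult : ∀ x y : A, α (μ x y) = μ (α x) (α y))
    (hassoc : ∀ x y z : A, μ (α x) (μ y z) = μ (μ x y) (α z))
    (mul_one : ∀ x : A, μ x one = α x) (one_mul : ∀ x : A, μ one x = α x)
    (alpha_one : α one = one) :
    ∀ i j k : ℕ, i + j ≤ k →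
      μ (combEvalU μ α one x i k) (combEvalU μ α one x j k) = α (combEvalU μ α one x (i + j) k)
  | i, 0, k, _ => mul_one _
  | 0, j + 1, k, _ => by simpa [combEvalU] using one_mul _
  | i + 1, 1, k + 1, h => by
    have hk : 1 ≤ k := by omega
    obtain ⟨k, rfl⟩ := Nat.exists_eq_add_of_le' hk
    rw [← alpha_combEvalU μ α one x mult alpha_one (i + 1) (k + 1) (by omega)]
    simp [combEvalU, mult, pow_succ']
  | i + 1, j + 2, k + 2, h => by
    have ih := mul_combEvalU mult hassoc mul_one one_mul alpha_one (i + 1) (j + 1) (k + 1)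
      (by omega)
    rw [← alpha_combEvalU μ α one x mult alpha_one (i + 1) (k + 1) (by omega),
      show i + 1 + (j + 2) = i + 1 + j + 2 by omega]
    simp only [combEvalU, hassoc, mult, show k + 2 - 1 = k + 1 by omega, ih]
    rw [show i + 1 + (j + 1) = i + 1 + j + 1 by omega]

end HomAssociative

/-- The truncated exponential `exp_p(sx) = Σ_{i=0}^p (sⁱ/i!) R_x(i,p) νⁱ`
satisfies, coefficientwise in `ν`:
(a) `exp_p(sx) ∨ exp_p(tx) = α(exp_p((s+t)x))` modulo `ν^{p+1}`, and
(b) `exp_p(sx) ∨ exp_p(−sx) = 𝟙` modulo `ν^{p+1}`. -/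
theorem truncated_exponential_group_like {K A : Type*} [Field K] [AddCommGroup A] [Module K A]
    (μ : A →ₗ[K] A →ₗ[K] A) (α : A →ₗ[K] A) (one : A)
    (mult : ∀ x y : A, α (μ x y) = μ (α x) (α y))
    (hassoc : ∀ x y z : A, μ (α x) (μ y z) = μ (μ x y) (α z))
    (mul_one : ∀ x : A, μ x one = α x)
    (one_mul : ∀ x : A, μ one x = α x)
    (alpha_one : α one = one)
    (x : A) (p : ℕ) (hp : 1 ≤ p) :
    (∀ s t : K, ∀ m : ℕ, m ≤ p →
      ∑ i ∈ Finset.range (m + 1),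
          ((m.choose i : K) * s ^ i * t ^ (m - i)) •
            μ (combEvalU μ α one x i p) (combEvalU μ α one x (m - i) p)
        = (s + t) ^ m • α (combEvalU μ α one x m p)) ∧
    (∀ s : K, ∀ m : ℕ, 1 ≤ m → m ≤ p →
      ∑ i ∈ Finset.range (m + 1),
          ((m.choose i : K) * (-1 : K) ^ (m - i) * s ^ m) •
            μ (combEvalU μ α one x i p) (combEvalU μ α one x (m - i) p)
        = 0) := by
  have main : ∀ s t : K, ∀ m : ℕ, m ≤ p →
      ∑ i ∈ Finset.range (m + 1),
          ((m.choose i : K) * s ^ i * t ^ (m - i)) •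
            μ (combEvalU μ α one x i p) (combEvalU μ α one x (m - i) p)
        = (s + t) ^ m • α (combEvalU μ α one x m p) := by
    intro s t m hm
    rw [add_pow, Finset.sum_smul]
    refine Finset.sum_congr rfl fun i hi => ?_
    have him : i + (m - i) = m := by have := Finset.mem_range.mp hi; omega
    rw [mul_combEvalU μ α one x mult hassoc mul_one one_mul alpha_one i (m - i) p (by omega), him]
    congr 1
    ring
  refine ⟨main, fun s m hm hmp => ?_⟩
  have h := main s (-s) m hmp
  rw [add_neg_cancel, zero_pow (by omega), zero_smul] at h
  rw [← h]
  refine Finset.sum_congr rfl fun i hi => ?_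
  have him : i + (m - i) = m := by have := Finset.mem_range.mp hi; omega
  have hs : s ^ m = s ^ i * s ^ (m - i) := by rw [← pow_add, him]
  congr 1
  rw [neg_pow s (m - i), hs]
  ring
end
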